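/- Let x0, h, φ ∈ ℝⁿ with ‖x0‖₂ = ‖φ‖₂ = 1, let α = ⟨φ, x0⟩ with 0 < α ≤ 1, let Ω = supp(x0) with |Ω| ≤ k, let λ > 0 and set ξ = λ√k, and assume ξ < (3/4)·α. If ⟨φ, h⟩ ≥ λ·⟨sign(x0), h_Ω⟩ + λ·‖h_{Ω^c}‖₁, then ‖h‖₁ ≤ (3.5/ξ)·√k·‖h‖₂. In particular, if h ≠ 0 then ‖h‖₁/‖h‖₂ ≤ (3.5/ξ)·√k. -/

import Mathlib

/-- The ℓ² (Euclidean) norm on ℝⁿ. -/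
noncomputable def l2norm {n : ℕ} (x : Fin n → ℝ) : ℝ := Real.sqrt (∑ j, (x j) ^ 2)

/-- The ℓ¹ norm on ℝⁿ. -/
noncomputable def l1norm {n : ℕ} (x : Fin n → ℝ) : ℝ := ∑ j, |x j|

/-- The Euclidean inner product on ℝⁿ. -/
noncomputable def dot {n : ℕ} (x y : Fin n → ℝ) : ℝ := ∑ j, x j * y j

lemma l2norm_nonneg {n : ℕ} (x : Fin n → ℝ) : 0 ≤ l2norm x := Real.sqrt_nonneg _

lemma dot_le_l2norm_mul_l2norm {n : ℕ} (x y : Fin n → ℝ) :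
    dot x y ≤ l2norm x * l2norm y :=
  Real.sum_mul_le_sqrt_mul_sqrt Finset.univ x y

lemma l1norm_indicator_add_compl {n : ℕ} (s : Set (Fin n)) (x : Fin n → ℝ) :
    l1norm (s.indicator x) + l1norm (sᶜ.indicator x) = l1norm x := by
  classical
  simp only [l1norm, ← Finset.sum_add_distrib]
  refine Finset.sum_congr rfl fun j _ => ?_
  by_cases hj : j ∈ s <;> simp [hj]

lemma l1norm_indicator_le {n : ℕ} (s : Set (Fin n)) (x : Fin n → ℝ) :
    l1norm (s.indicator x) ≤ Real.sqrt s.ncard * l2norm x := by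
  classical
  have hcs := dot_le_l2norm_mul_l2norm (s.indicator 1) fun j => |x j|
  have hdot : dot (s.indicator 1) (fun j => |x j|) = l1norm (s.indicator x) := by
    refine Finset.sum_congr rfl fun j _ => ?_
    by_cases hj : j ∈ s <;> simp [hj]
  have hcard : l2norm (s.indicator (1 : Fin n → ℝ)) = Real.sqrt s.ncard := by
    rw [Set.ncard_eq_toFinset_card', ← Set.filter_mem_univ_eq_toFinset]
    simp [l2norm, Set.indicator_apply]
  have habs : l2norm (fun j => |x j|) = l2norm x := by simp [l2norm]
  rwa [hdot, hcard, habs] at hcs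

lemma neg_l1norm_le_dot_sign {n : ℕ} (x y : Fin n → ℝ) :
    -l1norm y ≤ dot (fun j => Real.sign (x j)) y := by
  simp only [l1norm, dot, ← Finset.sum_neg_distrib]
  refine Finset.sum_le_sum fun j _ => ?_
  rcases Real.sign_apply_eq (x j) with hs | hs | hs <;> rw [hs]
  · linarith [le_abs_self (y j)]
  · simp
  · linarith [neg_abs_le (y j)]

lemma l2norm_pos {n : ℕ} {x : Fin n → ℝ} (hx : x ≠ 0) : 0 < l2norm x := by
  obtain ⟨j, hj⟩ := Function.ne_iff.mp hx
  have hj' : x j ≠ 0 := hj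
  exact Real.sqrt_pos.mpr
    (Finset.sum_pos' (fun i _ => sq_nonneg (x i)) ⟨j, Finset.mem_univ j, by positivity⟩)

/-- **Effective sparsity of the perturbation.** With `‖x0‖₂ = ‖φ‖₂ = 1`,
`α = ⟨φ, x0⟩ ∈ (0, 1]`, `Ω = supp(x0)`, `|Ω| ≤ k`, `ξ = λ√k`, and `ξ < (3/4)·α`, the
subgradient inequality `⟨φ, h⟩ ≥ λ·⟨sign(x0), h_Ω⟩ + λ·‖h_{Ω^c}‖₁` implies
`‖h‖₁ ≤ (3.5/ξ)·√k·‖h‖₂`; in particular, if `h ≠ 0` then `‖h‖₁/‖h‖₂ ≤ (3.5/ξ)·√k`. -/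
theorem h_effective_sparsity {n k : ℕ} (x0 h φ : Fin n → ℝ) (lam α ξ : ℝ)
    (hx0 : l2norm x0 = 1) (hφ : l2norm φ = 1) (hα : α = dot φ x0)
    (hαpos : 0 < α) (hα1 : α ≤ 1)
    (hk : (Function.support x0).ncard ≤ k)
    (hlam : 0 < lam) (hξ : ξ = lam * Real.sqrt k) (hξα : ξ < (3 / 4) * α)
    (hsub : dot φ h ≥
      lam * dot (fun j => Real.sign (x0 j)) ((Function.support x0).indicator h) +
        lam * l1norm ((Function.support x0)ᶜ.indicator h)) :
    l1norm h ≤ (3.5 / ξ) * Real.sqrt k * l2norm h ∧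
      (h ≠ 0 → l1norm h / l2norm h ≤ (3.5 / ξ) * Real.sqrt k) := by
  have hkpos : 0 < k := by
    refine lt_of_lt_of_le ?_ hk
    rw [Set.ncard_pos, Function.support_nonempty_iff]
    rintro rfl
    simp [l2norm] at hx0
  have hsqrt : 0 < Real.sqrt k := Real.sqrt_pos.mpr (by exact_mod_cast hkpos)
  have hconst : 3.5 / ξ * Real.sqrt k = 3.5 / lam := by
    rw [hξ]
    field_simp
  have hbound : l1norm h ≤ 3.5 / ξ * Real.sqrt k * l2norm h := by
    rw [hconst, div_mul_eq_mul_div, le_div_iff₀ hlam]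
    have hnn := l2norm_nonneg h
    have hcs : dot φ h ≤ l2norm h := by
      simpa [hφ] using dot_le_l2norm_mul_l2norm φ h
    have hsplit := l1norm_indicator_add_compl (Function.support x0) h
    have hΩ : l1norm ((Function.support x0).indicator h) ≤ Real.sqrt k * l2norm h := by
      refine (l1norm_indicator_le _ h).trans (mul_le_mul_of_nonneg_right ?_ hnn)
      exact Real.sqrt_le_sqrt (by exact_mod_cast hk)
    have hsign := mul_le_mul_of_nonneg_left
      (neg_l1norm_le_dot_sign x0 ((Function.support x0).indicator h)) hlam.le
    have hΩ' : lam * l1norm ((Function.support x0).indicator h) ≤ ξ * l2norm h := by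
      rw [hξ, mul_assoc]
      exact mul_le_mul_of_nonneg_left hΩ hlam.le
    have hξ' : ξ * l2norm h ≤ 3 / 4 * l2norm h :=
      mul_le_mul_of_nonneg_right (by linarith) hnn
    rw [← hsplit]
    linarith
  exact ⟨hbound, fun hh => (div_le_iff₀ (l2norm_pos hh)).mpr hbound⟩
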